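/- (Channel-level cancellation identity underlying Theorem 1, Fig. 4.) Let Λ_S, Λ_M, Λ_1, …, Λ_T be invertible Pauli-diagonal maps on n qubits, G_1,…,G_T unitaries whose conjugation maps send every Pauli matrix to ± a Pauli matrix (Clifford layers), U_1,…,U_T unitaries, and D an invertible Pauli-diagonal map commuting with each conjugation 𝒰_t. With the gauge-transformed channels Λ_{S,η} = D∘Λ_S, Λ_{M,η} = Λ_M∘D^{−1}, Λ_{t,η} = (𝒢_t^{−1}∘D∘𝒢_t)∘Λ_t∘D^{−1}, one has the operator identity Λ_M ∘ (Λ_{M,η})^{−1} ∘ 𝒢_T ∘ Λ_T ∘ (Λ_{T,η})^{−1} ∘ 𝒰_T ∘ ⋯ ∘ 𝒢_1 ∘ Λ_1 ∘ (Λ_{1,η})^{−1} ∘ 𝒰_1 ∘ (Λ_{S,η})^{−1} ∘ Λ_S = 𝒢_T ∘ 𝒰_T ∘ ⋯ ∘ 𝒢_1 ∘ 𝒰_1 as linear maps on 2^n×2^n complex matrices; i.e., inverting the gauge-transformed noise channels exactly cancels the true noise everywhere in the circuit. -/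

import Mathlib

open Matrix Finset

noncomputable section

/-- The four single-qubit Pauli matrices: `σ₀ = I`, `σ₁ = X`, `σ₂ = Y`, `σ₃ = Z`. -/
def pauli1 : Fin 4 → Matrix (Fin 2) (Fin 2) ℂ
  | 0 => 1
  | 1 => !![0, 1; 1, 0]
  | 2 => !![0, -Complex.I; Complex.I, 0]
  | 3 => !![1, 0; 0, -1]

/-- The `n`-qubit Pauli matrix `P_a = σ_{a 1} ⊗ ⋯ ⊗ σ_{a n}` (Kronecker product realized
as a matrix indexed by `Fin n → Fin 2`). -/
def PauliMat (n : ℕ) (a : Fin n → Fin 4) :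
    Matrix (Fin n → Fin 2) (Fin n → Fin 2) ℂ :=
  fun x y => ∏ i, pauli1 (a i) (x i) (y i)

/-- The symplectic pairing `⟨a,b⟩`: the parity of the number of sites where the two Pauli
strings are both nontrivial and differ (so that `P_a P_b = (-1)^⟨a,b⟩ P_b P_a`).
The value is the parity, an element of `{0,1}`. -/
def pairing {n : ℕ} (a b : Fin n → Fin 4) : ℕ :=
  (Finset.univ.filter fun i => a i ≠ 0 ∧ b i ≠ 0 ∧ a i ≠ b i).card % 2

/-- The Pauli-diagonal map `Λ(ρ) = Σ_a c_a P_a ρ P_a`. -/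
def pauliDiag (n : ℕ) (c : (Fin n → Fin 4) → ℂ) :
    Matrix (Fin n → Fin 2) (Fin n → Fin 2) ℂ → Matrix (Fin n → Fin 2) (Fin n → Fin 2) ℂ :=
  fun ρ => ∑ a, c a • (PauliMat n a * ρ * PauliMat n a)

/-- Conjugation channel `ρ ↦ U ρ U†` of a unitary `U`. -/
def conjAct {m : Type*} [Fintype m] (U : Matrix m m ℂ) (ρ : Matrix m m ℂ) : Matrix m m ℂ :=
  U * ρ * Uᴴ

/-- Conjugation `𝒫_a : ρ ↦ P_a ρ P_a` by a Pauli matrix. -/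
def pconj (n : ℕ) (a : Fin n → Fin 4) (ρ : Matrix (Fin n → Fin 2) (Fin n → Fin 2) ℂ) :
    Matrix (Fin n → Fin 2) (Fin n → Fin 2) ℂ :=
  PauliMat n a * ρ * PauliMat n a

/-- Run a `T`-layer circuit: apply `step 0`, then `step 1`, …, then `step (T-1)`. -/
def runCirc {M : Type*} (T : ℕ) (step : Fin T → M → M) (ρ : M) : M :=
  (List.ofFn step).foldl (fun σ f => f σ) ρ

lemma pauli1_mul_comm (a b : Fin 4) :
    ∃ ε : ℂ, ε * ε = 1 ∧ pauli1 a * pauli1 b = ε • (pauli1 b * pauli1 a) := by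
  by_cases h : a = 0 ∨ b = 0 ∨ a = b
  · refine ⟨1, by norm_num, ?_⟩
    rcases h with rfl | rfl | rfl <;> simp [pauli1]
  · refine ⟨-1, by norm_num, ?_⟩
    fin_cases a <;> fin_cases b <;> simp at h <;> simp [pauli1]

lemma PauliMat_mul_apply {n : ℕ} (a b : Fin n → Fin 4) (x z : Fin n → Fin 2) :
    (PauliMat n a * PauliMat n b) x z = ∏ i, (pauli1 (a i) * pauli1 (b i)) (x i) (z i) := by
  simp only [Matrix.mul_apply, PauliMat, Finset.prod_univ_sum, Fintype.piFinset_univ,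
    Finset.prod_mul_distrib]

/-- Two Pauli strings commute up to a sign. -/
lemma PauliMat_mul_comm {n : ℕ} (a b : Fin n → Fin 4) :
    ∃ ε : ℂ, ε * ε = 1 ∧ PauliMat n a * PauliMat n b = ε • (PauliMat n b * PauliMat n a) := by
  choose ε hε h using fun i => pauli1_mul_comm (a i) (b i)
  refine ⟨∏ i, ε i, by simp [← Finset.prod_mul_distrib, hε], ?_⟩
  ext x z
  simp [PauliMat_mul_apply, h, Finset.prod_mul_distrib]

lemma pconj_comm {n : ℕ} (a b : Fin n → Fin 4) (ρ : Matrix (Fin n → Fin 2) (Fin n → Fin 2) ℂ) :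
    pconj n a (pconj n b ρ) = pconj n b (pconj n a ρ) := by
  obtain ⟨ε, hε, h⟩ := PauliMat_mul_comm a b
  have h' : PauliMat n b * PauliMat n a = ε • (PauliMat n a * PauliMat n b) := by
    rw [h, smul_smul, hε, one_smul]
  calc pconj n a (pconj n b ρ)
      = PauliMat n a * PauliMat n b * ρ * (PauliMat n b * PauliMat n a) := by
        simp only [pconj, mul_assoc]
    _ = ε • (PauliMat n b * PauliMat n a) * ρ * ε • (PauliMat n a * PauliMat n b) :=
        congrArg₂ (fun A B => A * ρ * B) h h'
    _ = pconj n b (pconj n a ρ) := by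
        rw [Matrix.smul_mul, Matrix.smul_mul, Matrix.mul_smul, smul_smul, hε, one_smul]
        simp only [pconj, mul_assoc]

/-- Pauli-diagonal maps commute. -/
lemma pauliDiag_comm {n : ℕ} (c d : (Fin n → Fin 4) → ℂ)
    (ρ : Matrix (Fin n → Fin 2) (Fin n → Fin 2) ℂ) :
    pauliDiag n c (pauliDiag n d ρ) = pauliDiag n d (pauliDiag n c ρ) := by
  have expand : ∀ c d : (Fin n → Fin 4) → ℂ, pauliDiag n c (pauliDiag n d ρ) =
      ∑ a, ∑ b, (c a * d b) • pconj n a (pconj n b ρ) := fun c d => by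
    simp only [pauliDiag, pconj, Finset.mul_sum, Finset.sum_mul, Finset.smul_sum,
      Matrix.mul_smul, Matrix.smul_mul, smul_smul]
  rw [expand, expand, Finset.sum_comm]
  exact Finset.sum_congr rfl fun b _ => Finset.sum_congr rfl fun a _ => by
    rw [pconj_comm, mul_comm]

lemma conjAct_conjTranspose_mul_mul {m : Type*} [Fintype m] [DecidableEq m] {G : Matrix m m ℂ}
    (hG : G ∈ Matrix.unitaryGroup m ℂ) (ρ : Matrix m m ℂ) : conjAct G (Gᴴ * ρ * G) = ρ := by
  have h : G * Gᴴ = 1 := Matrix.mem_unitaryGroup_iff.1 hG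
  calc conjAct G (Gᴴ * ρ * G) = (G * Gᴴ) * ρ * (G * Gᴴ) := by simp only [conjAct, mul_assoc]
    _ = ρ := by rw [h, one_mul, mul_one]

/-- Conjugating a Pauli-diagonal map by a Clifford unitary gives a Pauli-diagonal map. -/
lemma exists_conjAct_pauliDiag {n : ℕ} {G : Matrix (Fin n → Fin 2) (Fin n → Fin 2) ℂ}
    (hG : G ∈ Matrix.unitaryGroup (Fin n → Fin 2) ℂ)
    (hCliff : ∀ a : Fin n → Fin 4, ∃ b : Fin n → Fin 4,
      conjAct G (PauliMat n a) = PauliMat n b ∨ conjAct G (PauliMat n a) = -PauliMat n b)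
    (d : (Fin n → Fin 4) → ℂ) :
    ∃ d' : (Fin n → Fin 4) → ℂ, ∀ ρ,
      conjAct G (pauliDiag n d ρ) = pauliDiag n d' (conjAct G ρ) := by
  choose f hf using hCliff
  have hGG : Gᴴ * G = 1 := Matrix.mem_unitaryGroup_iff'.1 hG
  have conj_mul : ∀ A B, conjAct G (A * B) = conjAct G A * conjAct G B := fun A B => by
    calc conjAct G (A * B) = G * A * 1 * B * Gᴴ := by simp only [conjAct, mul_assoc, one_mul]
      _ = conjAct G A * conjAct G B := by rw [← hGG]; simp only [conjAct, mul_assoc]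
  refine ⟨fun b => ∑ a with f a = b, d a, fun ρ => ?_⟩
  calc conjAct G (pauliDiag n d ρ)
      = ∑ a, d a • conjAct G (PauliMat n a * ρ * PauliMat n a) := by
        simp only [conjAct, pauliDiag, Finset.mul_sum, Finset.sum_mul, Matrix.mul_smul,
          Matrix.smul_mul]
    _ = ∑ a, d a • (PauliMat n (f a) * conjAct G ρ * PauliMat n (f a)) := by
        refine Finset.sum_congr rfl fun a _ => ?_
        rw [conj_mul, conj_mul]
        rcases hf a with h | h <;> rw [h]
        simp
    _ = pauliDiag n (fun b => ∑ a with f a = b, d a) (conjAct G ρ) := by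
        rw [pauliDiag, ← Finset.sum_fiberwise _ f]
        refine Finset.sum_congr rfl fun b _ => ?_
        rw [Finset.sum_smul]
        refine Finset.sum_congr rfl fun a ha => ?_
        rw [(Finset.mem_filter.1 ha).2]

/-- A map intertwining the layers of two circuits intertwines the circuits. -/
lemma runCirc_semiconj {M : Type*} {T : ℕ} {step step' : Fin T → M → M} {E : M → M}
    (h : ∀ t σ, step t (E σ) = E (step' t σ)) (ρ : M) :
    runCirc T step (E ρ) = E (runCirc T step' ρ) := by
  induction T generalizing ρ with
  | zero => simp [runCirc]
  | succ T ih =>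
    have := ih (step := fun t => step t.succ) (step' := fun t => step' t.succ)
      (fun t σ => h t.succ σ) (step' 0 ρ)
    simpa [runCirc, List.ofFn_succ, h] using this

/-- Channel-level cancellation identity underlying Theorem 1: inserting the inverses of
the gauge-transformed channels `Λ_{S,η} = D∘Λ_S`, `Λ_{M,η} = Λ_M∘D⁻¹`,
`Λ_{t,η} = (𝒢_t⁻¹∘D∘𝒢_t)∘Λ_t∘D⁻¹` exactly cancels the true noise everywhere:
`Λ_M ∘ (Λ_{M,η})⁻¹ ∘ 𝒢_T ∘ Λ_T ∘ (Λ_{T,η})⁻¹ ∘ 𝒰_T ∘ ⋯ ∘ 𝒢_1 ∘ Λ_1 ∘ (Λ_{1,η})⁻¹ ∘ 𝒰_1 ∘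
(Λ_{S,η})⁻¹ ∘ Λ_S = 𝒢_T ∘ 𝒰_T ∘ ⋯ ∘ 𝒢_1 ∘ 𝒰_1`. -/
theorem channel_level_cancellation (n T : ℕ)
    (cS cM : (Fin n → Fin 4) → ℂ) (ct : Fin T → (Fin n → Fin 4) → ℂ)
    (d dinv : (Fin n → Fin 4) → ℂ)
    (hd : ∀ ρ, pauliDiag n d (pauliDiag n dinv ρ) = ρ)
    (hd' : ∀ ρ, pauliDiag n dinv (pauliDiag n d ρ) = ρ)
    (G U : Fin T → Matrix (Fin n → Fin 2) (Fin n → Fin 2) ℂ)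
    (hG : ∀ t, G t ∈ Matrix.unitaryGroup (Fin n → Fin 2) ℂ)
    (hCliff : ∀ (t : Fin T) (a : Fin n → Fin 4), ∃ b : Fin n → Fin 4,
      conjAct (G t) (PauliMat n a) = PauliMat n b ∨
      conjAct (G t) (PauliMat n a) = -PauliMat n b)
    (hU : ∀ t, U t ∈ Matrix.unitaryGroup (Fin n → Fin 2) ℂ)
    (hcomm : ∀ t ρ, pauliDiag n d (conjAct (U t) ρ) = conjAct (U t) (pauliDiag n d ρ))
    (invS invM : Matrix (Fin n → Fin 2) (Fin n → Fin 2) ℂ →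
      Matrix (Fin n → Fin 2) (Fin n → Fin 2) ℂ)
    (invt : Fin T → Matrix (Fin n → Fin 2) (Fin n → Fin 2) ℂ →
      Matrix (Fin n → Fin 2) (Fin n → Fin 2) ℂ)
    (hinvS : ∀ ρ, invS (pauliDiag n d (pauliDiag n cS ρ)) = ρ ∧
      pauliDiag n d (pauliDiag n cS (invS ρ)) = ρ)
    (hinvM : ∀ ρ, invM (pauliDiag n cM (pauliDiag n dinv ρ)) = ρ ∧
      pauliDiag n cM (pauliDiag n dinv (invM ρ)) = ρ)
    (hinvt : ∀ (t : Fin T) ρ,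
      invt t ((G t)ᴴ * pauliDiag n d (conjAct (G t)
          (pauliDiag n (ct t) (pauliDiag n dinv ρ))) * G t) = ρ ∧
      ((G t)ᴴ * pauliDiag n d (conjAct (G t)
          (pauliDiag n (ct t) (pauliDiag n dinv (invt t ρ)))) * G t) = ρ) :
    ∀ ρ : Matrix (Fin n → Fin 2) (Fin n → Fin 2) ℂ,
      pauliDiag n cM (invM
        (runCirc T (fun t σ =>
            conjAct (G t) (pauliDiag n (ct t) (invt t (conjAct (U t) σ))))
          (invS (pauliDiag n cS ρ)))) =
      runCirc T (fun t σ => conjAct (G t) (conjAct (U t) σ)) ρ := by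
  intro ρ
  have hS : invS (pauliDiag n cS ρ) = pauliDiag n dinv ρ := by
    have h := (hinvS (pauliDiag n dinv ρ)).1
    rwa [pauliDiag_comm d cS, hd] at h
  have hM : ∀ σ, pauliDiag n cM (invM (pauliDiag n dinv σ)) = σ := fun σ => by
    have h := congrArg (pauliDiag n d) (hinvM (pauliDiag n dinv σ)).2
    rwa [pauliDiag_comm cM dinv, hd, hd] at h
  have hstep : ∀ t σ, conjAct (G t) (pauliDiag n (ct t) (invt t
      (conjAct (U t) (pauliDiag n dinv σ)))) =
      pauliDiag n dinv (conjAct (G t) (conjAct (U t) σ)) := fun t σ => by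
    obtain ⟨d', hd'G⟩ := exists_conjAct_pauliDiag (hG t) (hCliff t) d
    set τ := conjAct (U t) (pauliDiag n dinv σ) with hτ
    have hDτ : pauliDiag n d τ = conjAct (U t) σ := by rw [hτ, hcomm, hd]
    have h := congrArg (conjAct (G t)) (hinvt t τ).2
    rw [conjAct_conjTranspose_mul_mul (hG t)] at h
    have h₁ := congrArg (pauliDiag n dinv) h
    rw [hd', pauliDiag_comm (ct t) dinv] at h₁
    have h₂ := congrArg (pauliDiag n d') h₁
    rwa [← hd'G, hd, pauliDiag_comm d' dinv, ← hd'G, hDτ] at h₂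
  rw [hS, runCirc_semiconj hstep, hM]

end
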